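/- arXiv:math/0406110 — 3 statements merged into one kernel-verified Lean document; each statement's English description precedes it below -/
import Mathlib

section
/- Fix β > 1 and constants B, C < ∞. Then there is a function γ = γ(β,B,C,·) : (0,∞) → ℝ with γ(β,B,C,T) → 1 as T → ∞ such that the following holds. Let T > 0, let (q_x)_{x ∈ ℝ} be a measurable family of probability densities on [0,∞) with ∫_0^∞ t^β q_x(t) dt ≤ B for all x and q_x(t) ≤ C for all x and all t ∈ [0,1], and let f : ℝ → [0,∞) be bounded, satisfy f(x) = ∫_0^∞ f(x−t) q_x(t) dt for all x > 0, and satisfy f(x) > 1 for all x ∈ [−T, 0]. Then f(x) ≥ γ(β,B,C,T) for every x > 0. -/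
open MeasureTheory

/-- Tangent-line bound for the convex function `s ↦ s ^ (1 - β)`. -/
lemma rpow_one_sub_sub_ge {β s δ : ℝ} (hβ : 1 < β) (hδ : δ < s) (hs : 0 < s) :
    δ * (β - 1) * s ^ (-β) ≤ (s - δ) ^ (1 - β) - s ^ (1 - β) := by
  have hy : 0 < 1 - δ / s := by
    rw [sub_pos, div_lt_one hs]; exact hδ
  have hbern : 1 + (β - 1) * (δ / s) ≤ (1 - δ / s) ^ (1 - β) := by
    rw [Real.rpow_def_of_pos hy]
    have h1 := Real.add_one_le_exp (Real.log (1 - δ / s) * (1 - β))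
    have h2 := Real.log_le_sub_one_of_pos hy
    nlinarith
  have hsplit : (s - δ) ^ (1 - β) = s ^ (1 - β) * (1 - δ / s) ^ (1 - β) := by
    rw [← Real.mul_rpow hs.le hy.le]
    congr 1
    field_simp
  have hpow : s ^ (-β) = s ^ (1 - β) / s := by
    rw [← Real.rpow_sub_one hs.ne']
    congr 1
    ring
  have hpos : 0 < s ^ (1 - β) := Real.rpow_pos_of_pos hs _
  rw [hsplit, hpow]
  have := mul_le_mul_of_nonneg_left hbern hpos.le
  calc δ * (β - 1) * (s ^ (1 - β) / s)
      = s ^ (1 - β) * (1 + (β - 1) * (δ / s)) - s ^ (1 - β) := by ring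
    _ ≤ _ := by linarith

/-- Maximum principle: a bounded function which is nonpositive on `(-∞, 0]` and bounded on
`(0, ∞)` by its averages to the left is nonpositive, provided that every average puts mass at
least `1 / 2` at distance at least `δ`. -/
lemma nonpos_of_le_integral_left (μ : ℝ → Measure ℝ) [∀ x, IsProbabilityMeasure (μ x)]
    {δ K : ℝ} (hδ : 0 < δ) (hμ : ∀ x, ∀ᵐ t ∂μ x, 0 ≤ t)
    (hμδ : ∀ x, (μ x).real (Set.Iio δ) ≤ 1 / 2)
    {v : ℝ → ℝ} (hv : Measurable v) (hvK : ∀ x, |v x| ≤ K)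
    (hsub : ∀ x, 0 < x → v x ≤ ∫ t, v (x - t) ∂μ x) (hv0 : ∀ x ≤ 0, v x ≤ 0) (x : ℝ) :
    v x ≤ 0 := by
  have hK : 0 ≤ K := (abs_nonneg _).trans (hvK 0)
  have hstep : ∀ n : ℕ, ∀ x ≤ n * δ, v x ≤ 0 := by
    intro n
    induction n with
    | zero => simpa using hv0
    | succ n ih =>
      have hgeom : ∀ m : ℕ, ∀ x ≤ ((n + 1 : ℕ) : ℝ) * δ, v x ≤ K * (1 / 2) ^ m := by
        intro m
        induction m with
        | zero => intro x _; simpa using (abs_le.1 (hvK x)).2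
        | succ m ihm =>
          intro x hx
          rcases le_or_gt x 0 with hx0 | hx0
          · exact (hv0 x hx0).trans (by positivity)
          have hint : Integrable (fun t => v (x - t)) (μ x) :=
            Integrable.of_bound (hv.comp (measurable_const.sub measurable_id)).aestronglyMeasurable
              K (Filter.Eventually.of_forall fun t => hvK _)
          calc v x ≤ ∫ t, v (x - t) ∂μ x := hsub x hx0
            _ ≤ ∫ t, (Set.Iio δ).indicator (fun _ => K * (1 / 2) ^ m) t ∂μ x := by
                refine integral_mono_ae hint
                  ((integrable_const _).indicator measurableSet_Iio) ?_
                filter_upwards [hμ x] with t ht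
                by_cases h : t < δ
                · rw [Set.indicator_of_mem (Set.mem_Iio.2 h)]
                  exact ihm _ (by linarith)
                · rw [Set.indicator_of_notMem (by simpa using h)]
                  refine ih _ ?_
                  push_cast at hx
                  linarith
            _ = (μ x).real (Set.Iio δ) * (K * (1 / 2) ^ m) := by
                rw [integral_indicator_const _ measurableSet_Iio, smul_eq_mul]
            _ ≤ 1 / 2 * (K * (1 / 2) ^ m) := by gcongr; exact hμδ x
            _ = K * (1 / 2) ^ (m + 1) := by ring
      intro x hx
      have hlim : Filter.Tendsto (fun m : ℕ => K * (1 / 2 : ℝ) ^ m) Filter.atTop (nhds 0) := by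
        simpa using (tendsto_pow_atTop_nhds_zero_of_lt_one
          (by norm_num : (0 : ℝ) ≤ 1 / 2) (by norm_num)).const_mul K
      exact ge_of_tendsto' hlim fun m => hgeom m x hx
  obtain ⟨n, hn⟩ := exists_nat_ge (x / δ)
  exact hstep n x ((div_le_iff₀ hδ).1 hn)

/-- If the jump laws have the tail bound `μ x (s, ∞) ≤ b * s ^ (-β)` and jump at least `δ` with
probability at least `1 / 2`, then a bounded nonnegative solution of `f x = ∫ f (x - t) ∂μ x`
which is at least `1` on `[-T, 0]` is almost at least `1` on `(0, ∞)`. -/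
lemma one_sub_le_of_eq_integral_left (μ : ℝ → Measure ℝ) [∀ x, IsProbabilityMeasure (μ x)]
    {β δ b T A : ℝ} (hβ : 1 < β) (hδ : 0 < δ) (hδ1 : δ ≤ 1) (hb : 0 ≤ b) (hT : 1 < T)
    (hμ : ∀ x, ∀ᵐ t ∂μ x, 0 ≤ t) (hμδ : ∀ x, (μ x).real (Set.Iio δ) ≤ 1 / 2)
    (htail : ∀ x s, 0 < s → (μ x).real (Set.Ioi s) ≤ b * s ^ (-β))
    {f : ℝ → ℝ} (hf : Measurable f) (hf0 : ∀ x, 0 ≤ f x) (hfA : ∀ x, f x ≤ A)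
    (hfμ : ∀ x, 0 < x → f x = ∫ t, f (x - t) ∂μ x) (hf1 : ∀ x ∈ Set.Icc (-T) (0 : ℝ), 1 ≤ f x)
    (x : ℝ) (hx : 0 < x) :
    1 - 2 * b / (δ * (β - 1)) * (T - 1) ^ (1 - β) ≤ f x := by
  set c : ℝ := 2 * b / (δ * (β - 1)) with hc
  have hβ' : 0 < β - 1 := by linarith
  have hc0 : 0 ≤ c := by positivity
  -- the barrier, increasing on `[-1, ∞)`
  set G : ℝ → ℝ := fun y => (Set.Ici (-1 : ℝ)).indicator
    (fun y => c * ((T - 1) ^ (1 - β) - (y + T) ^ (1 - β))) y with hG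
  have hGval : ∀ y, -1 ≤ y → G y = c * ((T - 1) ^ (1 - β) - (y + T) ^ (1 - β)) := fun y hy =>
    Set.indicator_of_mem (Set.mem_Ici.2 hy) _
  have hGzero : ∀ y < -1, G y = 0 := fun y hy =>
    Set.indicator_of_notMem (by simpa using hy) _
  have hGm : Measurable G := by
    refine Measurable.indicator ?_ measurableSet_Ici
    fun_prop
  have hGmono_aux : ∀ y z, -1 ≤ y → y ≤ z → (z + T) ^ (1 - β) ≤ (y + T) ^ (1 - β) :=
    fun y z hy hyz =>
      Real.rpow_le_rpow_of_nonpos (by linarith) (by linarith) (by linarith)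
  have hG0 : ∀ y, 0 ≤ G y := by
    intro y
    rcases lt_or_ge y (-1) with h | h
    · rw [hGzero y h]
    · rw [hGval y h]
      have := hGmono_aux (-1) y le_rfl h
      rw [show -1 + T = T - 1 by ring] at this
      exact mul_nonneg hc0 (by linarith)
  have hGle : ∀ y, G y ≤ c * (T - 1) ^ (1 - β) := by
    intro y
    have h1 : 0 < (T - 1) ^ (1 - β) := Real.rpow_pos_of_pos (by linarith) _
    rcases lt_or_ge y (-1) with h | h
    · rw [hGzero y h]; positivity
    · rw [hGval y h]
      have : 0 < (y + T) ^ (1 - β) := Real.rpow_pos_of_pos (by linarith) _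
      gcongr
      linarith
  have hGmono : Monotone G := by
    intro y z hyz
    rcases lt_or_ge y (-1) with h | h
    · rw [hGzero y h]; exact hG0 z
    · rw [hGval y h, hGval z (h.trans hyz)]
      have := hGmono_aux y z h hyz
      gcongr
  have hGinc : ∀ y, 0 < y → 2 * (b * (y + T) ^ (-β)) ≤ G y - G (y - δ) := by
    intro y hy
    rw [hGval y (by linarith), hGval (y - δ) (by linarith)]
    have h := mul_le_mul_of_nonneg_left
      (rpow_one_sub_sub_ge (s := y + T) (δ := δ) hβ (by linarith) (by linarith)) hc0
    have e : c * (δ * (β - 1) * (y + T) ^ (-β)) = 2 * (b * (y + T) ^ (-β)) := by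
      rw [hc]; field_simp
    rw [e] at h
    rw [show y - δ + T = y + T - δ by ring]
    linarith
  set I : ℝ → ℝ := fun y => (Set.Iio (-T)).indicator (fun _ => (1 : ℝ)) y with hI
  have hIm : Measurable I := measurable_const.indicator measurableSet_Iio
  have hI0 : ∀ y, 0 ≤ I y := fun y => Set.indicator_nonneg (fun _ _ => zero_le_one) y
  have hI1 : ∀ y, I y ≤ 1 := fun y => Set.indicator_le_self' (fun _ _ => zero_le_one) y
  have hmeas : ∀ y : ℝ, Measurable fun t : ℝ => y - t := fun y =>
    measurable_const.sub measurable_id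
  have hfint : ∀ y, Integrable (fun t => f (y - t)) (μ y) := fun y =>
    Integrable.of_bound (hf.comp (hmeas y)).aestronglyMeasurable A
      (Filter.Eventually.of_forall fun t => by
        rw [Real.norm_of_nonneg (hf0 _)]; exact hfA _)
  have hGint : ∀ y, Integrable (fun t => G (y - t)) (μ y) := fun y =>
    Integrable.of_bound (hGm.comp (hmeas y)).aestronglyMeasurable (c * (T - 1) ^ (1 - β))
      (Filter.Eventually.of_forall fun t => by
        rw [Real.norm_of_nonneg (hG0 _)]; exact hGle _)
  have hIint : ∀ y, Integrable (fun t => I (y - t)) (μ y) := fun y =>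
    Integrable.of_bound (hIm.comp (hmeas y)).aestronglyMeasurable 1
      (Filter.Eventually.of_forall fun t => by
        rw [Real.norm_of_nonneg (hI0 _)]; exact hI1 _)
  have hIval : ∀ y, ∫ t, I (y - t) ∂μ y = (μ y).real (Set.Ioi (y + T)) := by
    intro y
    have : (fun t => I (y - t)) = (Set.Ioi (y + T)).indicator (fun _ => (1 : ℝ)) := by
      funext t
      simp only [hI, Set.indicator_apply, Set.mem_Iio, Set.mem_Ioi]
      congr 1
      exact propext ⟨fun h => by linarith, fun h => by linarith⟩
    rw [this, integral_indicator_const _ measurableSet_Ioi, smul_eq_mul, mul_one]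
  have hGavg : ∀ y, ∫ t, G (y - t) ∂μ y ≤ G (y - δ) + 1 / 2 * (G y - G (y - δ)) := by
    intro y
    have hd : 0 ≤ G y - G (y - δ) := sub_nonneg.2 (hGmono (by linarith))
    calc ∫ t, G (y - t) ∂μ y
        ≤ ∫ t, (G (y - δ) + (Set.Iio δ).indicator (fun _ => G y - G (y - δ)) t) ∂μ y := by
          refine integral_mono_ae (hGint y) ((integrable_const _).add
            ((integrable_const _).indicator measurableSet_Iio)) ?_
          filter_upwards [hμ y] with t ht
          by_cases h : t < δ
          · rw [Set.indicator_of_mem (Set.mem_Iio.2 h)]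
            have := hGmono (show y - t ≤ y by linarith)
            linarith
          · rw [Set.indicator_of_notMem (by simpa using h), add_zero]
            exact hGmono (by linarith)
      _ = G (y - δ) + (μ y).real (Set.Iio δ) * (G y - G (y - δ)) := by
          rw [integral_add (integrable_const _)
            ((integrable_const _).indicator measurableSet_Iio),
            integral_indicator_const _ measurableSet_Iio, smul_eq_mul]
          simp
      _ ≤ _ := by gcongr; exact hμδ y
  have hsplit : ∀ y, ∫ t, (1 - f (y - t) - I (y - t) - G (y - t)) ∂μ y =
      1 - ∫ t, f (y - t) ∂μ y - ∫ t, I (y - t) ∂μ y - ∫ t, G (y - t) ∂μ y := by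
    intro y
    have i1 : Integrable (fun t => 1 - f (y - t)) (μ y) := (integrable_const _).sub (hfint y)
    have i2 : Integrable (fun t => 1 - f (y - t) - I (y - t)) (μ y) := i1.sub (hIint y)
    rw [integral_sub i2 (hGint y), integral_sub i1 (hIint y),
      integral_sub (integrable_const _) (hfint y)]
    simp
  have hmain := nonpos_of_le_integral_left μ hδ hμ hμδ
    (v := fun y => 1 - f y - I y - G y) (K := 2 + A + c * (T - 1) ^ (1 - β))
    (((measurable_const.sub hf).sub hIm).sub hGm) (fun y => by
      have := hf0 y; have := hfA y; have := hI0 y; have := hI1 y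
      have := hG0 y; have := hGle y
      rw [abs_le]; constructor <;> linarith) (fun y hy => by
      rw [hsplit y, ← hfμ y hy, hIval y]
      have h1 := hGavg y
      have h2 := htail y (y + T) (by linarith)
      have h3 := hGinc y hy
      have h4 := hI0 y
      linarith) (fun y hy => by
      have h1 := hG0 y
      rcases lt_or_ge y (-T) with h | h
      · have : I y = 1 := Set.indicator_of_mem (Set.mem_Iio.2 h) _
        have := hf0 y
        linarith
      · have := hf1 y ⟨h, hy⟩
        have := hI0 y
        linarith) x
  have hIx : I x = 0 := Set.indicator_of_notMem (by simp; linarith) _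
  have := hGle x
  simp only [hIx] at hmain
  linarith

/-- The law on `(0, ∞)` with density `p`. -/
noncomputable def jumpLaw (p : ℝ → ℝ) : Measure ℝ :=
  (volume.restrict (Set.Ioi (0 : ℝ))).withDensity fun t => ENNReal.ofReal (p t)

lemma isProbabilityMeasure_jumpLaw {p : ℝ → ℝ} (hp0 : ∀ t, 0 ≤ p t)
    (hp1 : ∫ t in Set.Ioi (0 : ℝ), p t = 1) : IsProbabilityMeasure (jumpLaw p) := by
  have hint : Integrable p (volume.restrict (Set.Ioi (0 : ℝ))) := by
    by_contra h
    rw [integral_undef h] at hp1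
    exact zero_ne_one hp1
  constructor
  rw [jumpLaw, withDensity_apply _ MeasurableSet.univ, Measure.restrict_univ,
    ← ofReal_integral_eq_lintegral_ofReal hint (Filter.Eventually.of_forall hp0), hp1,
    ENNReal.ofReal_one]

lemma ae_jumpLaw_nonneg (p : ℝ → ℝ) : ∀ᵐ t ∂jumpLaw p, 0 ≤ t := by
  refine (withDensity_absolutelyContinuous _ _).ae_le ?_
  filter_upwards [ae_restrict_mem measurableSet_Ioi] with t ht
  exact (Set.mem_Ioi.1 ht).le

lemma integral_jumpLaw {p : ℝ → ℝ} (hp : Measurable p) (hp0 : ∀ t, 0 ≤ p t) (g : ℝ → ℝ) :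
    ∫ t, g t ∂jumpLaw p = ∫ t in Set.Ioi (0 : ℝ), g t * p t := by
  rw [jumpLaw, integral_withDensity_eq_integral_toReal_smul hp.ennreal_ofReal
    (Filter.Eventually.of_forall fun t => ENNReal.ofReal_lt_top)]
  refine integral_congr_ae (Filter.Eventually.of_forall fun t => ?_)
  simp only [ENNReal.toReal_ofReal (hp0 t), smul_eq_mul]
  ring

lemma jumpLaw_real_Iio_le {p : ℝ → ℝ} {C δ : ℝ} (hC : 0 ≤ C) (hδ : 0 ≤ δ) (hδ1 : δ ≤ 1)
    (hpC : ∀ t ∈ Set.Icc (0 : ℝ) 1, p t ≤ C) : (jumpLaw p).real (Set.Iio δ) ≤ C * δ := by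
  refine ENNReal.toReal_le_of_le_ofReal (by positivity) ?_
  rw [jumpLaw, withDensity_apply _ measurableSet_Iio, Measure.restrict_restrict measurableSet_Iio]
  calc ∫⁻ t in Set.Iio δ ∩ Set.Ioi 0, ENNReal.ofReal (p t)
      ≤ ∫⁻ _ in Set.Iio δ ∩ Set.Ioi 0, ENNReal.ofReal C := by
        refine setLIntegral_mono measurable_const fun t ht => ENNReal.ofReal_le_ofReal ?_
        exact hpC t ⟨(Set.mem_Ioi.1 ht.2).le, (Set.mem_Iio.1 ht.1).le.trans hδ1⟩
    _ = ENNReal.ofReal (C * δ) := by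
        rw [setLIntegral_const, Set.inter_comm, Set.Ioi_inter_Iio, Real.volume_Ioo, sub_zero,
          ENNReal.ofReal_mul hC]

lemma jumpLaw_real_Ioi_le {p : ℝ → ℝ} (hp : Measurable p) {β b s : ℝ} (hβ : 0 ≤ β) (hb : 0 ≤ b)
    (hs : 0 < s)
    (hmom : ∫⁻ t in Set.Ioi (0 : ℝ), ENNReal.ofReal (t ^ β * p t) ≤ ENNReal.ofReal b) :
    (jumpLaw p).real (Set.Ioi s) ≤ b * s ^ (-β) := by
  have hsβ : 0 < s ^ β := Real.rpow_pos_of_pos hs β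
  have hmom' : ∫⁻ t, ENNReal.ofReal (t ^ β) ∂jumpLaw p ≤ ENNReal.ofReal b := by
    rw [jumpLaw, lintegral_withDensity_eq_lintegral_mul _ hp.ennreal_ofReal (by fun_prop)]
    refine le_trans (le_of_eq (setLIntegral_congr_fun measurableSet_Ioi fun t ht => ?_)) hmom
    simp only [Pi.mul_apply]
    rw [ENNReal.ofReal_mul (Real.rpow_nonneg (Set.mem_Ioi.1 ht).le β), mul_comm]
  have hmarkov := (mul_meas_ge_le_lintegral₀ (μ := jumpLaw p)
    (f := fun t => ENNReal.ofReal (t ^ β)) (by fun_prop) (ENNReal.ofReal (s ^ β))).trans hmom'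
  refine ENNReal.toReal_le_of_le_ofReal (by positivity) ?_
  rw [Real.rpow_neg hs.le, ← div_eq_mul_inv, ENNReal.ofReal_div_of_pos hsβ,
    ENNReal.le_div_iff_mul_le (Or.inl (by simpa using hsβ)) (Or.inl ENNReal.ofReal_ne_top),
    mul_comm]
  refine le_trans (mul_le_mul_right (measure_mono fun t ht => ?_) _) hmarkov
  exact ENNReal.ofReal_le_ofReal (Real.rpow_le_rpow hs.le (Set.mem_Ioi.1 ht).le hβ)

open MeasureTheory

/-- **Theorem (absorption threshold for self-averaging solutions).** Fix `β > 1` and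
constants `B, C`. There is a function `γ(β,B,C,·)` of `T` with `γ(β,B,C,T) → 1` as
`T → ∞`, such that for every `T > 0`, every measurable family `(q_x)` of probability
densities on `[0,∞)` with `β`-moments uniformly bounded by `B` and uniformly bounded by
`C` on `[0,1]`, and every bounded nonnegative measurable `f` satisfying the
self-averaging equation `f x = ∫_0^∞ f (x−t) q_x(t) dt` for `x > 0` and `f > 1` on
`[−T,0]`, one has `f x ≥ γ(β,B,C,T)` for every `x > 0`. -/
theorem selfAveraging_absorption
    (β B C : ℝ) (hβ : 1 < β) :
    ∃ γ : ℝ → ℝ, Filter.Tendsto γ Filter.atTop (nhds 1) ∧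
      ∀ T > (0:ℝ), ∀ q : ℝ → ℝ → ℝ,
        (Measurable fun pr : ℝ × ℝ => q pr.1 pr.2) →
        (∀ x t : ℝ, 0 ≤ q x t) →
        (∀ x : ℝ, ∀ t < (0:ℝ), q x t = 0) →
        (∀ x : ℝ, (∫ t in Set.Ioi (0:ℝ), q x t) = 1) →
        (∀ x : ℝ, (∫⁻ t in Set.Ioi (0:ℝ), ENNReal.ofReal (t ^ β * q x t)) ≤
          ENNReal.ofReal B) →
        (∀ x : ℝ, ∀ t ∈ Set.Icc (0:ℝ) 1, q x t ≤ C) →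
        ∀ f : ℝ → ℝ, Measurable f → (∀ x, 0 ≤ f x) → (∃ A : ℝ, ∀ x, f x ≤ A) →
          (∀ x, 0 < x → f x = ∫ t in Set.Ioi (0:ℝ), f (x - t) * q x t) →
          (∀ x ∈ Set.Icc (-T) (0:ℝ), 1 < f x) →
          ∀ x, 0 < x → γ T ≤ f x := by
  set δ : ℝ := 1 / (2 * (|C| + 1)) with hδ
  have hδ0 : 0 < δ := by positivity
  have hδ1 : δ ≤ 1 := by
    rw [hδ, div_le_one (by positivity)]
    linarith [abs_nonneg C]
  have hCδ : |C| * δ ≤ 1 / 2 := by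
    rw [hδ, mul_one_div, div_le_div_iff₀ (by positivity) (by norm_num)]
    linarith
  refine ⟨fun T => if 1 < T then 1 - 2 * |B| / (δ * (β - 1)) * (T - 1) ^ (1 - β) else 0, ?_, ?_⟩
  · have hpow : Filter.Tendsto (fun T : ℝ => (T - 1) ^ (1 - β)) Filter.atTop (nhds 0) := by
      have h := (tendsto_rpow_neg_atTop (sub_pos.2 hβ)).comp
        (Filter.tendsto_atTop_add_const_right Filter.atTop (-1 : ℝ) Filter.tendsto_id)
      simpa [Function.comp_def, sub_eq_add_neg] using h
    have hlim := (hpow.const_mul (2 * |B| / (δ * (β - 1)))).const_sub 1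
    rw [mul_zero, sub_zero] at hlim
    refine hlim.congr' ?_
    filter_upwards [Filter.eventually_gt_atTop (1 : ℝ)] with T hT
    rw [if_pos hT]
  · rintro T - q hq hq0 - hq1 hqB hqC f hf hf0 ⟨A, hfA⟩ hfq hf1 x hx
    beta_reduce
    split_ifs with hT
    · have hqm : ∀ y, Measurable (q y) := fun y => hq.comp measurable_prodMk_left
      have : ∀ y, IsProbabilityMeasure (jumpLaw (q y)) := fun y =>
        isProbabilityMeasure_jumpLaw (hq0 y) (hq1 y)
      refine one_sub_le_of_eq_integral_left (fun y => jumpLaw (q y)) hβ hδ0 hδ1 (abs_nonneg B) hT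
        (fun y => ae_jumpLaw_nonneg _)
        (fun y => (jumpLaw_real_Iio_le (abs_nonneg C) hδ0.le hδ1 fun t ht =>
          (hqC y t ht).trans (le_abs_self C)).trans hCδ)
        (fun y s hs => jumpLaw_real_Ioi_le (hqm y) (by linarith) (abs_nonneg B) hs
          ((hqB y).trans (ENNReal.ofReal_le_ofReal (le_abs_self B))))
        hf hf0 hfA (fun y hy => ?_) (fun y hy => (hf1 y hy).le) x hx
      rw [integral_jumpLaw (hqm y) (hq0 y), ← hfq y hy]
    · exact hf0 x
end

section
/- Fix β > 1 and constants B, C < ∞. Let (q_y)_{y ∈ ℝ} be a measurable family of probability densities on [0,∞) with ∫_0^∞ t^β q_y(t) dt ≤ B for all y and q_y(t) ≤ C for all y and t ∈ [0,1]. Let (X_n)_{n ≥ 0} be the Markov chain on ℝ with X_0 = x which moves only to the left: given X_n = y, the step t = y − X_{n+1} is distributed with density q_y(t) on [0,∞). Then there is γ = γ(β,B,C,T) with γ(β,B,C,T) → 1 as T → ∞ such that for every T > 0 and every starting point x > 0, the probability that the chain visits [−T, 0] (i.e. ℙ_x(∃ n ≥ 0 with X_n ∈ [−T,0])) is at least γ(β,B,C,T).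 -/
open MeasureTheory

/-- `IsLeftChainLaw q x P` : `P` is the law (on the path space `ℕ → ℝ`) of the Markov
chain started at `x` which moves only to the left, the step from a current position `y`
having probability density `q y` on `[0,∞)`; i.e. `X_0 = x` a.s. and, conditionally on
the past `(X_0,…,X_n)`, the next position `X_{n+1} = u` has density `u ↦ q (X_n) (X_n − u)`
with respect to Lebesgue measure. -/
def IsLeftChainLaw (q : ℝ → ℝ → ℝ) (x : ℝ) (P : Measure (ℕ → ℝ)) : Prop :=
  IsProbabilityMeasure P ∧
  P {ω | ω 0 = x} = 1 ∧
  ∀ n : ℕ, ∀ S : Set (Fin (n + 1) → ℝ), MeasurableSet S →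
    ∀ Bs : Set ℝ, MeasurableSet Bs →
      P {ω | (fun i : Fin (n + 1) => ω i) ∈ S ∧ ω (n + 1) ∈ Bs} =
        ∫⁻ ω in {ω : ℕ → ℝ | (fun i : Fin (n + 1) => ω i) ∈ S},
          (∫⁻ u in Bs, ENNReal.ofReal (q (ω n) (ω n - u))) ∂P

open Set Filter Topology

namespace IsLeftChainLaw

variable {q : ℝ → ℝ → ℝ} {x : ℝ} {P : Measure (ℕ → ℝ)}

/-- A uniform bound on one-step transition probabilities from `A` to `D` bounds the
probability of being in `A` at time `n` and in `D` at time `n + 1`. -/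
lemma measure_step_le (h : IsLeftChainLaw q x P) (n : ℕ) {A D : Set ℝ}
    (hA : MeasurableSet A) (hD : MeasurableSet D) {c : ENNReal}
    (hc : ∀ y ∈ A, ∫⁻ u in D, ENNReal.ofReal (q y (y - u)) ≤ c) :
    P {ω | ω n ∈ A ∧ ω (n + 1) ∈ D} ≤ c * P {ω | ω n ∈ A} := by
  have hS : MeasurableSet {s : Fin (n + 1) → ℝ | s (Fin.last n) ∈ A} :=
    measurable_pi_apply _ hA
  have key := h.2.2 n _ hS D hD
  simp only [mem_ofPred_eq, Fin.val_last] at key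
  rw [key]
  refine (setLIntegral_mono_ae' (g := fun _ => c) (measurable_pi_apply n hA)
    (ae_of_all _ fun ω hω => hc _ hω)).trans ?_
  rw [setLIntegral_const]
  rfl

lemma ae_antitone (h : IsLeftChainLaw q x P) (hq : ∀ y : ℝ, ∀ t < (0 : ℝ), q y t = 0) :
    ∀ᵐ ω ∂P, Antitone ω := by
  have key : ∀ (n : ℕ) (r : ℚ), ∀ᵐ ω ∂P, ¬ (ω n ∈ Iio (r : ℝ) ∧ ω (n + 1) ∈ Ioi (r : ℝ)) := by
    intro n r
    have := h.measure_step_le n (A := Iio (r : ℝ)) (D := Ioi (r : ℝ)) (c := 0)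
      measurableSet_Iio measurableSet_Ioi (fun y hy => by
        rw [setLIntegral_congr_fun (g := fun _ => 0) measurableSet_Ioi]
        · simp
        · intro u hu
          have : q y (y - u) = 0 := hq _ _ (sub_neg.2 (lt_trans hy hu))
          simp [this])
    rw [ae_iff]
    simpa using this
  filter_upwards [ae_all_iff.2 fun n => ae_all_iff.2 (key n)] with ω hω
  refine antitone_nat_of_succ_le fun n => ?_
  by_contra! hlt
  obtain ⟨r, h1, h2⟩ := exists_rat_btwn hlt
  exact hω n r ⟨h1, h2⟩

/-- If from every point of an interval the chain leaves it in one step with probability at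
least `1 / 2`, then the expected time spent in that interval is at most `2`. -/
lemma tsum_measure_mem_le_two (h : IsLeftChainLaw q x P) (hq : ∀ y : ℝ, ∀ t < (0 : ℝ), q y t = 0)
    {I : Set ℝ} (hI : MeasurableSet I) (hconn : I.OrdConnected)
    (hstay : ∀ y ∈ I, ∫⁻ u in I, ENNReal.ofReal (q y (y - u)) ≤ 1 / 2) :
    ∑' n, P {ω | ω n ∈ I} ≤ 2 := by
  have := h.1
  have hm : ∀ n, MeasurableSet {ω : ℕ → ℝ | ω n ∈ I} := fun n => measurable_pi_apply n hI
  let E : ℕ → Set (ℕ → ℝ) := fun n => {ω | ω n ∈ I} \ {ω | ω (n + 1) ∈ I}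
  have hE : ∑' n, P (E n) ≤ 1 := by
    rw [← measure_iUnion₀ _ fun n => ((hm n).diff (hm (n + 1))).nullMeasurableSet]
    · exact prob_le_one
    · refine (Std.Symm.pairwise_on (r := AEDisjoint P) E).2 ?_
      intro m n hmn
      have h0 : ∀ᵐ ω ∂P, ω ∉ E m ∩ E n := by
        filter_upwards [h.ae_antitone hq] with ω hω hmem
        exact hmem.1.2 (hconn.out hmem.2.1 hmem.1.1 ⟨hω hmn, hω (Nat.le_succ m)⟩)
      simpa [AEDisjoint, ae_iff] using h0
  refine ENNReal.tsum_le_of_sum_range_le fun N => ?_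
  set s := ∑ n ∈ Finset.range N, P {ω | ω n ∈ I}
  have hfin : s ≠ ⊤ := (ENNReal.sum_lt_top.2 fun n _ => measure_lt_top P _).ne
  have hle : s ≤ 1 + 1 / 2 * s := by
    calc s = ∑ n ∈ Finset.range N,
          (P (E n) + P {ω | ω n ∈ I ∧ ω (n + 1) ∈ I}) := by
            refine Finset.sum_congr rfl fun n _ => ?_
            rw [add_comm]
            exact (measure_inter_add_sdiff _ (hm (n + 1))).symm
      _ ≤ ∑ n ∈ Finset.range N, (P (E n) + 1 / 2 * P {ω | ω n ∈ I}) := by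
            gcongr with n
            exact h.measure_step_le n hI hI hstay
      _ ≤ 1 + 1 / 2 * s := by
            rw [Finset.sum_add_distrib, ← Finset.mul_sum]
            gcongr
            exact (ENNReal.sum_le_tsum _).trans hE
  clear_value s
  lift s to NNReal using hfin
  have h2 : (s : ℝ) ≤ 1 + 1 / 2 * s := by
    have := ENNReal.toReal_mono (by finiteness) hle
    rw [ENNReal.toReal_add (by finiteness) (by finiteness), ENNReal.toReal_mul] at this
    simpa using this
  have h3 : s ≤ 2 := by
    rw [← NNReal.coe_le_coe]
    push_cast
    linarith
  exact_mod_cast h3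

end IsLeftChainLaw

/-- Density bounded by `C` near `0`: short intervals are left with probability `≥ 1 / 2`. -/
lemma setLIntegral_step_Ioc_le_half {f : ℝ → ℝ} {C D a b y : ℝ} (hD : 1 ≤ D) (hCD : C ≤ D)
    (hf : ∀ t < (0 : ℝ), f t = 0) (hC : ∀ t ∈ Icc (0 : ℝ) 1, f t ≤ C)
    (hab : b - a = 1 / (2 * D)) (hy : y ∈ Ioc a b) :
    ∫⁻ u in Ioc a b, ENNReal.ofReal (f (y - u)) ≤ 1 / 2 := by
  have hδ : 1 / (2 * D) ≤ 1 := by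
    rw [div_le_one (by linarith)]
    linarith
  calc ∫⁻ u in Ioc a b, ENNReal.ofReal (f (y - u))
      ≤ ∫⁻ _ in Ioc a b, ENNReal.ofReal D := by
        refine setLIntegral_mono_ae' measurableSet_Ioc (ae_of_all _ fun u hu => ?_)
        apply ENNReal.ofReal_le_ofReal
        rcases lt_or_ge (y - u) 0 with hlt | hge
        · rw [hf _ hlt]
          linarith
        · exact (hC _ ⟨hge, by linarith [hu.1, hy.2]⟩).trans hCD
    _ = 1 / 2 := by
        rw [setLIntegral_const, Real.volume_Ioc, hab, ← ENNReal.ofReal_mul (by linarith)]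
        have : D * (1 / (2 * D)) = 1 / 2 := by field_simp
        rw [this, ENNReal.ofReal_div_of_pos (by norm_num)]
        simp

/-- Markov's inequality for the probability to jump from `y > 0` over `[-T, 0]`. -/
lemma setLIntegral_step_Iio_le {f : ℝ → ℝ} {β B T a y : ℝ} (hβ : 0 ≤ β)
    (hpos : ∀ t, 0 ≤ f t)
    (hB : ∫⁻ t in Ioi (0 : ℝ), ENNReal.ofReal (t ^ β * f t) ≤ ENNReal.ofReal B)
    (ha : 0 < T + a) (hy : a ≤ y) :
    ∫⁻ u in Iio (-T), ENNReal.ofReal (f (y - u)) ≤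
      ENNReal.ofReal ((T + a) ^ (-β)) * ENNReal.ofReal B := by
  let F : ℝ → ENNReal := (Ioi (0 : ℝ)).indicator fun t => ENNReal.ofReal (t ^ β * f t)
  calc ∫⁻ u in Iio (-T), ENNReal.ofReal (f (y - u))
      ≤ ∫⁻ u in Iio (-T), ENNReal.ofReal ((T + a) ^ (-β)) * F (y - u) := by
        refine setLIntegral_mono_ae' measurableSet_Iio (ae_of_all _ fun u hu => ?_)
        have hu' : T + a ≤ y - u := by linarith [mem_Iio.1 hu]
        have hF : F (y - u) = ENNReal.ofReal ((y - u) ^ β * f (y - u)) :=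
          indicator_of_mem (mem_Ioi.2 (ha.trans_le hu')) _
        rw [hF, ← ENNReal.ofReal_mul (by positivity), ← mul_assoc]
        apply ENNReal.ofReal_le_ofReal
        refine le_mul_of_one_le_left (hpos _) ?_
        rw [Real.rpow_neg ha.le, inv_mul_eq_div, one_le_div (by positivity)]
        exact Real.rpow_le_rpow ha.le hu' hβ
    _ ≤ ∫⁻ u, ENNReal.ofReal ((T + a) ^ (-β)) * F (y - u) := setLIntegral_le_lintegral _ _
    _ = ENNReal.ofReal ((T + a) ^ (-β)) * ∫⁻ t, F t := by
        rw [lintegral_const_mul' _ _ ENNReal.ofReal_ne_top, lintegral_sub_left_eq_self]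
    _ ≤ _ := by
        gcongr
        rwa [lintegral_indicator measurableSet_Ioi]

lemma summable_add_mul_rpow_neg {β T δ : ℝ} (hβ : 1 < β) (hT : 0 < T) (hδ : 0 < δ) :
    Summable fun k : ℕ => (T + k * δ) ^ (-β) := by
  have hm : 0 < min T δ := lt_min hT hδ
  have hs : Summable fun k : ℕ => (min T δ) ^ (-β) * ((k + 1 : ℕ) : ℝ) ^ (-β) :=
    ((summable_nat_add_iff 1).2 (Real.summable_nat_rpow.2 (neg_lt_neg hβ))).mul_left _
  refine Summable.of_nonneg_of_le (fun k => by positivity) (fun k => ?_) hs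
  rw [← Real.mul_rpow hm.le (by positivity)]
  refine Real.rpow_le_rpow_of_nonpos (by positivity) ?_ (by linarith)
  push_cast
  have hk : (0 : ℝ) ≤ k := k.cast_nonneg
  nlinarith [min_le_left T δ, min_le_right T δ]

lemma tendsto_tsum_add_mul_rpow_neg {β δ : ℝ} (hβ : 1 < β) (hδ : 0 < δ) :
    Tendsto (fun T : ℝ => ∑' k : ℕ, (T + k * δ) ^ (-β)) atTop (𝓝 0) := by
  have := tendsto_tsum_of_dominated_convergence (𝓕 := atTop)
    (f := fun (T : ℝ) (k : ℕ) => (T + k * δ) ^ (-β)) (g := fun _ => 0)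
    (summable_add_mul_rpow_neg hβ one_pos hδ)
    (fun k => (tendsto_rpow_neg_atTop (by linarith)).comp
      (tendsto_atTop_add_const_right _ _ tendsto_id)) ?_
  · simpa using this
  · filter_upwards [eventually_ge_atTop 1] with T hT k
    rw [Real.norm_of_nonneg (by positivity)]
    exact Real.rpow_le_rpow_of_nonpos (by positivity) (by linarith) (by linarith)

/-- **Theorem (hitting the interval `[−T,0]`).** Fix `β > 1` and constants `B, C`. There
is `γ(β,B,C,T)` with `γ(β,B,C,T) → 1` as `T → ∞` such that for every `T > 0`, every
measurable family `(q_y)` of probability densities on `[0,∞)` with `β`-moments uniformly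
bounded by `B` and uniformly bounded by `C` on `[0,1]`, every starting point `x > 0` and
every law `P` of the associated leftward Markov chain, the probability that the chain
visits `[−T,0]` is at least `γ(β,B,C,T)`. -/
theorem leftChain_hits_interval
    (β B C : ℝ) (hβ : 1 < β) :
    ∃ γ : ℝ → ℝ, Filter.Tendsto γ Filter.atTop (nhds 1) ∧
      ∀ T > (0:ℝ), ∀ q : ℝ → ℝ → ℝ,
        (Measurable fun pr : ℝ × ℝ => q pr.1 pr.2) →
        (∀ y t : ℝ, 0 ≤ q y t) →
        (∀ y : ℝ, ∀ t < (0:ℝ), q y t = 0) →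
        (∀ y : ℝ, (∫ t in Set.Ioi (0:ℝ), q y t) = 1) →
        (∀ y : ℝ, (∫⁻ t in Set.Ioi (0:ℝ), ENNReal.ofReal (t ^ β * q y t)) ≤
          ENNReal.ofReal B) →
        (∀ y : ℝ, ∀ t ∈ Set.Icc (0:ℝ) 1, q y t ≤ C) →
        ∀ x : ℝ, 0 < x → ∀ P : Measure (ℕ → ℝ), IsLeftChainLaw q x P →
          ENNReal.ofReal (γ T) ≤ P {ω | ∃ n : ℕ, ω n ∈ Set.Icc (-T) (0:ℝ)} := by
  set D := max C 1
  have hD1 : 1 ≤ D := le_max_right _ _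
  set δ := 1 / (2 * D)
  have hδ : 0 < δ := by positivity
  set b := max B 0
  have hb0 : 0 ≤ b := le_max_right _ _
  refine ⟨fun T => 1 - 2 * b * ∑' k : ℕ, (T + k * δ) ^ (-β), ?_, ?_⟩
  · simpa using ((tendsto_tsum_add_mul_rpow_neg hβ hδ).const_mul (2 * b)).const_sub 1
  intro T hT q _ hpos hneg _ hB hC x hx P hP
  have := hP.1
  let I : ℕ → Set ℝ := fun k => Ioc (k * δ) ((k + 1) * δ)
  have hI : ∀ k, MeasurableSet (I k) := fun k => measurableSet_Ioc
  have hvisit : ∀ k, ∑' n, P {ω | ω n ∈ I k} ≤ 2 := fun k =>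
    hP.tsum_measure_mem_le_two hneg (hI k) ordConnected_Ioc fun y hy =>
      setLIntegral_step_Ioc_le_half hD1 (le_max_left C 1) (hneg y) (hC y) (by ring) hy
  have hcover : ∀ y : ℝ, 0 < y → ∃ k : ℕ, (k : ℝ) < y / δ ∧ y ∈ I k := by
    intro y hy
    have hyδ : 0 < y / δ := div_pos hy hδ
    obtain ⟨k, hk⟩ := Nat.exists_eq_succ_of_ne_zero (Nat.ceil_pos.2 hyδ).ne'
    have h1 : y / δ ≤ k + 1 := by
      have := Nat.le_ceil (y / δ)
      rw [hk] at this
      exact_mod_cast this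
    have h2 : (k : ℝ) < y / δ := Nat.lt_ceil.1 (by omega)
    exact ⟨k, h2, (lt_div_iff₀ hδ).1 h2, (div_le_iff₀ hδ).1 h1⟩
  let J : Set (ℕ → ℝ) := ⋃ k, ⋃ n, {ω | ω n ∈ I k ∧ ω (n + 1) ∈ Iio (-T)}
  have hJ : P J ≤ ENNReal.ofReal (2 * b * ∑' k : ℕ, (T + k * δ) ^ (-β)) := by
    calc P J ≤ ∑' k, ∑' n, P {ω | ω n ∈ I k ∧ ω (n + 1) ∈ Iio (-T)} :=
          (measure_iUnion_le _).trans (ENNReal.tsum_le_tsum fun k => measure_iUnion_le _)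
      _ ≤ ∑' k : ℕ, ∑' n, ENNReal.ofReal ((T + k * δ) ^ (-β)) * ENNReal.ofReal B *
            P {ω | ω n ∈ I k} := by
          refine ENNReal.tsum_le_tsum fun k => ENNReal.tsum_le_tsum fun n => ?_
          refine hP.measure_step_le n (hI k) measurableSet_Iio fun y hy => ?_
          exact setLIntegral_step_Iio_le (by linarith) (hpos y) (hB y) (by positivity) hy.1.le
      _ ≤ ∑' k : ℕ, ENNReal.ofReal (2 * b * (T + k * δ) ^ (-β)) := by
          refine ENNReal.tsum_le_tsum fun k => ?_
          rw [ENNReal.tsum_mul_left]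
          calc _ ≤ ENNReal.ofReal ((T + k * δ) ^ (-β)) * ENNReal.ofReal b * 2 := by
                gcongr
                · exact le_max_left _ _
                · exact hvisit k
            _ = _ := by
                rw [← ENNReal.ofReal_ofNat 2, ← ENNReal.ofReal_mul (by positivity),
                  ← ENNReal.ofReal_mul (by positivity)]
                congr 1
                ring
      _ = _ := by
          rw [← ENNReal.ofReal_tsum_of_nonneg (fun k => by positivity)
            ((summable_add_mul_rpow_neg hβ hT hδ).mul_left _), tsum_mul_left]
  have hx0 : ∀ᵐ ω ∂P, ω 0 = x :=
    (mem_ae_iff_prob_eq_one (measurableSet_eq_fun (measurable_pi_apply 0) measurable_const)).2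
      hP.2.1
  have hleave : ∀ k, ∀ᵐ ω ∂P, ∀ᶠ n in atTop, ω ∉ {ω : ℕ → ℝ | ω n ∈ I k} := fun k =>
    ae_eventually_notMem ((hvisit k).trans_lt ENNReal.ofNat_lt_top).ne
  have hae : ∀ᵐ ω ∂P, ω ∈ {ω : ℕ → ℝ | ∃ n : ℕ, ω n ∈ Icc (-T) (0:ℝ)} ∪ J := by
    filter_upwards [hx0, hP.ae_antitone hneg, ae_all_iff.2 hleave] with ω h0 hanti hev
    have hex : ∃ n, ω n ≤ 0 := by
      by_contra! hall
      have hev' : ∀ᶠ n in atTop, ∀ k ∈ Finset.range ⌈x / δ⌉₊, ω n ∉ I k :=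
        (Finset.eventually_all _).2 fun k _ => hev k
      obtain ⟨n, hn⟩ := hev'.exists
      obtain ⟨k, hk, hmem⟩ := hcover _ (hall n)
      refine hn k (Finset.mem_range.2 (Nat.lt_ceil.2 (hk.trans_le ?_))) hmem
      have : ω n ≤ x := h0 ▸ hanti (Nat.zero_le n)
      gcongr
    classical
    obtain ⟨n, hn⟩ : ∃ n, Nat.find hex = n + 1 := by
      refine Nat.exists_eq_succ_of_ne_zero fun h => ?_
      have := Nat.find_spec hex
      rw [h, h0] at this
      linarith
    have hle : ω (n + 1) ≤ 0 := hn ▸ Nat.find_spec hex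
    have hgt : 0 < ω n := not_le.1 (Nat.find_min hex (by omega))
    rcases le_or_gt (-T) (ω (n + 1)) with h | h
    · exact Or.inl ⟨n + 1, h, hle⟩
    · obtain ⟨k, -, hk⟩ := hcover _ hgt
      exact Or.inr (mem_iUnion₂.2 ⟨k, n, hk, h⟩)
  have hone : 1 ≤ P {ω : ℕ → ℝ | ∃ n : ℕ, ω n ∈ Icc (-T) (0:ℝ)} + P J := by
    calc (1 : ENNReal) = P univ := measure_univ.symm
      _ ≤ P ({ω : ℕ → ℝ | ∃ n : ℕ, ω n ∈ Icc (-T) (0:ℝ)} ∪ J) :=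
          measure_mono_ae (hae.mono fun ω h _ => h)
      _ ≤ _ := measure_union_le _ _
  rw [ENNReal.ofReal_sub _ (mul_nonneg (by positivity) (tsum_nonneg fun k => by positivity)),
    ENNReal.ofReal_one, tsub_le_iff_right]
  exact hone.trans (by gcongr)
end

section
/- Let C < ∞, and let (q_y)_{y ∈ ℝ} be a measurable family of probability densities on [0,∞) with q_y(t) ≤ C for all y and all t ∈ [0,1]. Let (X_n)_{n ≥ 0} be the Markov chain on ℝ with X_0 = x which moves only to the left: given X_n = y, the step t = y − X_{n+1} is distributed with density q_y(t) on [0,∞). Then there is a constant K(C), depending only on C, such that for every starting point x and every a ∈ ℝ, the expected number of visits to the unit interval [a, a+1] satisfies Σ_{k=0}^∞ ℙ_x(X_k ∈ [a, a+1]) ≤ K(C). -/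
open MeasureTheory

/-- The one-step transition formula for the chain, for events of the form
`X_n ∈ A`, `X_{n+1} ∈ B`. -/
lemma IsLeftChainLaw.measure_step {q : ℝ → ℝ → ℝ} {x : ℝ} {P : Measure (ℕ → ℝ)}
    (hP : IsLeftChainLaw q x P) (n : ℕ) {A B : Set ℝ} (hA : MeasurableSet A)
    (hB : MeasurableSet B) :
    P {ω | ω n ∈ A ∧ ω (n + 1) ∈ B} =
      ∫⁻ ω in {ω : ℕ → ℝ | ω n ∈ A},
        (∫⁻ u in B, ENNReal.ofReal (q (ω n) (ω n - u))) ∂P := by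
  have hS : MeasurableSet {v : Fin (n + 1) → ℝ | v (Fin.last n) ∈ A} :=
    measurable_pi_apply (Fin.last n) hA
  simpa using hP.2.2 n _ hS B hB

/-- The chain almost surely does not move from below `b` to `[b, ∞)`. -/
lemma IsLeftChainLaw.measure_lt_and_le {q : ℝ → ℝ → ℝ} {x : ℝ} {P : Measure (ℕ → ℝ)}
    (hq : ∀ y : ℝ, ∀ t < (0 : ℝ), q y t = 0) (hP : IsLeftChainLaw q x P) (n : ℕ) (b : ℝ) :
    P {ω | ω n ∈ Set.Iio b ∧ ω (n + 1) ∈ Set.Ici b} = 0 := by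
  rw [hP.measure_step n measurableSet_Iio measurableSet_Ici]
  have hmeas : MeasurableSet {ω : ℕ → ℝ | ω n ∈ Set.Iio b} :=
    measurable_pi_apply n measurableSet_Iio
  rw [setLIntegral_congr_fun (g := fun _ => 0) hmeas, lintegral_zero]
  intro ω hω
  have hω' : ω n < b := hω
  dsimp only
  rw [setLIntegral_congr_fun (g := fun _ => 0) measurableSet_Ici, lintegral_zero]
  intro u hu
  have hu' : b ≤ u := hu
  simp [hq (ω n) (ω n - u) (by linarith)]

/-- The chain almost surely never moves to the right. -/
lemma IsLeftChainLaw.ae_succ_le {q : ℝ → ℝ → ℝ} {x : ℝ} {P : Measure (ℕ → ℝ)}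
    (hq : ∀ y : ℝ, ∀ t < (0 : ℝ), q y t = 0) (hP : IsLeftChainLaw q x P) (n : ℕ) :
    ∀ᵐ ω ∂P, ω (n + 1) ≤ ω n := by
  have h : ∀ᵐ ω ∂P, ∀ r : ℚ, ¬ (ω n ∈ Set.Iio (r : ℝ) ∧ ω (n + 1) ∈ Set.Ici (r : ℝ)) :=
    ae_all_iff.2 fun r => by
      simpa only [ae_iff, not_not] using hP.measure_lt_and_le hq n r
  filter_upwards [h] with ω hω
  by_contra! hlt
  obtain ⟨r, hr₁, hr₂⟩ := exists_rat_btwn hlt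
  exact hω r ⟨hr₁, hr₂.le⟩

/-- The chain stays in an interval of length `δ ≤ 1` for one more step with conditional
probability at most `1 / 2`, provided `C * δ ≤ 1 / 2`. -/
lemma IsLeftChainLaw.measure_stay_le {C δ : ℝ} {q : ℝ → ℝ → ℝ} {x : ℝ}
    {P : Measure (ℕ → ℝ)} (hq : ∀ y : ℝ, ∀ t < (0 : ℝ), q y t = 0)
    (hC : ∀ y : ℝ, ∀ t ∈ Set.Icc (0 : ℝ) 1, q y t ≤ C) (hδ₁ : δ ≤ 1)
    (hCδ : C * δ ≤ 1 / 2) (hP : IsLeftChainLaw q x P) (n : ℕ) (b : ℝ) :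
    P {ω | ω n ∈ Set.Icc b (b + δ) ∧ ω (n + 1) ∈ Set.Icc b (b + δ)} ≤
      2⁻¹ * P {ω | ω n ∈ Set.Icc b (b + δ)} := by
  rw [hP.measure_step n measurableSet_Icc measurableSet_Icc]
  have hmeas : MeasurableSet {ω : ℕ → ℝ | ω n ∈ Set.Icc b (b + δ)} :=
    measurable_pi_apply n measurableSet_Icc
  rw [← setLIntegral_const]
  refine setLIntegral_mono' hmeas fun ω hω => ?_
  obtain ⟨h₁, h₂⟩ : b ≤ ω n ∧ ω n ≤ b + δ := hω
  calc ∫⁻ u in Set.Icc b (b + δ), ENNReal.ofReal (q (ω n) (ω n - u))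
      ≤ ∫⁻ _ in Set.Icc b (b + δ), ENNReal.ofReal C := by
        refine setLIntegral_mono' measurableSet_Icc fun u hu => ?_
        rcases lt_or_ge (ω n - u) 0 with h | h
        · simp [hq _ _ h]
        · exact ENNReal.ofReal_le_ofReal (hC _ _ ⟨h, by linarith [hu.1]⟩)
    _ = ENNReal.ofReal (C * δ) := by
        rw [setLIntegral_const, Real.volume_Icc, ENNReal.ofReal_mul' (by linarith)]
        simp
    _ ≤ 2⁻¹ := by
        refine (ENNReal.ofReal_le_ofReal hCδ).trans_eq ?_
        rw [one_div, ENNReal.ofReal_inv_of_pos two_pos, ENNReal.ofReal_ofNat]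

/-- The expected number of visits to an interval of length `δ ≤ 1` with `C * δ ≤ 1 / 2`
is at most `2`. -/
lemma IsLeftChainLaw.tsum_measure_Icc_le_two {C δ : ℝ} {q : ℝ → ℝ → ℝ} {x : ℝ}
    {P : Measure (ℕ → ℝ)} (hq : ∀ y : ℝ, ∀ t < (0 : ℝ), q y t = 0)
    (hC : ∀ y : ℝ, ∀ t ∈ Set.Icc (0 : ℝ) 1, q y t ≤ C) (hδ₀ : 0 ≤ δ) (hδ₁ : δ ≤ 1)
    (hCδ : C * δ ≤ 1 / 2) (hP : IsLeftChainLaw q x P) (b : ℝ) :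
    ∑' k : ℕ, P {ω | ω k ∈ Set.Icc b (b + δ)} ≤ 2 := by
  have := hP.1
  have hsplit (k : ℕ) : P {ω | ω k ∈ Set.Icc b (b + δ)} + P {ω | ω k ∈ Set.Ioi (b + δ)} =
      P {ω | ω k ∈ Set.Ici b} := by
    have hdisj : Disjoint {ω : ℕ → ℝ | ω k ∈ Set.Icc b (b + δ)}
        {ω | ω k ∈ Set.Ioi (b + δ)} :=
      Set.disjoint_left.2 fun ω h₁ h₂ => absurd h₁.2 (not_le.2 h₂)
    have hmeas : MeasurableSet {ω : ℕ → ℝ | ω k ∈ Set.Ioi (b + δ)} :=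
      measurable_pi_apply k measurableSet_Ioi
    rw [← measure_union hdisj hmeas]
    change P ((fun ω : ℕ → ℝ => ω k) ⁻¹' (Set.Icc b (b + δ) ∪ Set.Ioi (b + δ))) = _
    rw [Set.Icc_union_Ioi_eq_Ici (by linarith)]
    rfl
  have hstep (k : ℕ) : P {ω | ω (k + 1) ∈ Set.Ici b} ≤
      2⁻¹ * P {ω | ω k ∈ Set.Icc b (b + δ)} + P {ω | ω k ∈ Set.Ioi (b + δ)} := by
    have hsub : {ω : ℕ → ℝ | ω (k + 1) ∈ Set.Ici b} ≤ᵐ[P]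
        ({ω | ω k ∈ Set.Icc b (b + δ) ∧ ω (k + 1) ∈ Set.Icc b (b + δ)} ∪
          {ω | ω k ∈ Set.Ioi (b + δ)} : Set (ℕ → ℝ)) := by
      filter_upwards [hP.ae_succ_le hq k] with ω hω hb
      have hb' : b ≤ ω (k + 1) := hb
      rcases lt_or_ge (b + δ) (ω k) with h | h
      · exact Or.inr h
      · exact Or.inl ⟨⟨hb'.trans hω, h⟩, hb', hω.trans h⟩
    refine (measure_mono_ae hsub).trans ((measure_union_le _ _).trans ?_)
    gcongr
    exact hP.measure_stay_le hq hC hδ₁ hCδ k b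
  have hpartial (N : ℕ) : ∑ k ∈ Finset.range N, 2⁻¹ * P {ω | ω k ∈ Set.Icc b (b + δ)} +
      P {ω | ω N ∈ Set.Ici b} ≤ 1 := by
    induction N with
    | zero => simpa using prob_le_one
    | succ N ih =>
      refine le_trans ?_ ih
      rw [Finset.sum_range_succ, ← hsplit N, add_assoc]
      refine add_le_add_right ?_ _
      calc _ ≤ 2⁻¹ * P {ω | ω N ∈ Set.Icc b (b + δ)} +
            (2⁻¹ * P {ω | ω N ∈ Set.Icc b (b + δ)} + P {ω | ω N ∈ Set.Ioi (b + δ)}) := by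
            exact add_le_add_right (hstep N) _
        _ = _ := by
            rw [← add_assoc, ← add_mul, ENNReal.inv_two_add_inv_two, one_mul]
  have hhalf : 2⁻¹ * ∑' k : ℕ, P {ω | ω k ∈ Set.Icc b (b + δ)} ≤ 1 := by
    rw [← ENNReal.tsum_mul_left]
    exact ENNReal.tsum_le_of_sum_range_le fun N => le_self_add.trans (hpartial N)
  rwa [mul_comm, ← div_eq_mul_inv,
    ENNReal.div_le_iff two_ne_zero ENNReal.ofNat_ne_top, one_mul] at hhalf

/-- An interval of length `1` is covered by `m + 1` consecutive intervals of length `1 / m`. -/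
lemma Icc_add_one_subset_iUnion {m : ℕ} (hm : 0 < m) (a : ℝ) :
    Set.Icc a (a + 1) ⊆
      ⋃ i ∈ Finset.range (m + 1), Set.Icc (a + i / m) (a + i / m + 1 / m) := by
  intro y hy
  have hm' : (0 : ℝ) < m := by exact_mod_cast hm
  have h₀ : 0 ≤ (y - a) * m := mul_nonneg (by linarith [hy.1]) hm'.le
  have hle := Nat.floor_le h₀
  have hlt := Nat.lt_floor_add_one ((y - a) * m)
  have hfl : ⌊(y - a) * m⌋₊ ≤ m :=
    Nat.floor_le_of_le (by nlinarith [hy.2])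
  simp only [Set.mem_iUnion]
  refine ⟨⌊(y - a) * m⌋₊, Finset.mem_range.2 (by omega), ?_, ?_⟩
  · have := (div_le_iff₀ hm').2 hle
    linarith
  · have := (le_div_iff₀ hm').2 hlt.le
    rw [add_div] at this
    linarith

/-- **Lemma (expected number of visits to a unit interval).** Let `C < ∞` and let `(q_y)`
be a measurable family of probability densities on `[0,∞)` uniformly bounded by `C` on
`[0,1]`. Then there is a constant `K(C)`, depending only on `C`, such that for every
starting point `x`, every `a ∈ ℝ` and every law `P` of the associated leftward Markov
chain, the expected number of visits to `[a, a+1]` satisfies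
`Σ_{k=0}^∞ P(X_k ∈ [a,a+1]) ≤ K(C)`. -/
theorem leftChain_expected_visits_le
    (C : ℝ) :
    ∃ K : ℝ, ∀ q : ℝ → ℝ → ℝ,
      (Measurable fun pr : ℝ × ℝ => q pr.1 pr.2) →
      (∀ y t : ℝ, 0 ≤ q y t) →
      (∀ y : ℝ, ∀ t < (0:ℝ), q y t = 0) →
      (∀ y : ℝ, (∫ t in Set.Ioi (0:ℝ), q y t) = 1) →
      (∀ y : ℝ, ∀ t ∈ Set.Icc (0:ℝ) 1, q y t ≤ C) →
      ∀ x a : ℝ, ∀ P : Measure (ℕ → ℝ), IsLeftChainLaw q x P →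
        (∑' k : ℕ, P {ω | ω k ∈ Set.Icc a (a + 1)}) ≤ ENNReal.ofReal K := by
  obtain ⟨m, hm⟩ := exists_nat_ge (max (2 * C) 1)
  have hm₁ : (1 : ℝ) ≤ m := (le_max_right _ _).trans hm
  have hm₀ : (0 : ℝ) < m := one_pos.trans_le hm₁
  have hCm : C * (1 / m) ≤ 1 / 2 := by
    rw [mul_one_div, div_le_div_iff₀ hm₀ two_pos]
    linarith [(le_max_left (2 * C) 1).trans hm]
  have hδ₁ : (1 : ℝ) / m ≤ 1 := (div_le_one hm₀).2 hm₁
  refine ⟨(m + 1 : ℕ) * 2, fun q _ _ hq _ hC x a P hP => ?_⟩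
  calc ∑' k : ℕ, P {ω | ω k ∈ Set.Icc a (a + 1)}
      ≤ ∑' k : ℕ, ∑ i ∈ Finset.range (m + 1),
          P {ω | ω k ∈ Set.Icc (a + i / m) (a + i / m + 1 / m)} := by
        refine ENNReal.tsum_le_tsum fun k => ?_
        refine le_trans (measure_mono ?_) (measure_biUnion_finset_le _ _)
        intro ω hω
        simpa using Icc_add_one_subset_iUnion (by exact_mod_cast hm₀) a hω
    _ = ∑ i ∈ Finset.range (m + 1), ∑' k : ℕ,
          P {ω | ω k ∈ Set.Icc (a + i / m) (a + i / m + 1 / m)} :=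
        Summable.tsum_finsetSum fun _ _ => ENNReal.summable
    _ ≤ ∑ _i ∈ Finset.range (m + 1), 2 :=
        Finset.sum_le_sum fun i _ =>
          hP.tsum_measure_Icc_le_two hq hC (by positivity) hδ₁ hCm _
    _ = ENNReal.ofReal ((m + 1 : ℕ) * 2) := by
        rw [ENNReal.ofReal_mul (by positivity), ENNReal.ofReal_natCast, ENNReal.ofReal_ofNat]
        simp
end
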